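/- arXiv:1409.2161 — 3 statements merged into one kernel-verified Lean document; each statement's English description precedes it below -/
import Mathlib

section
/- Let r ∈ ℕ, d = 3r, and 0 < η ≤ 1/2. There exist j ∈ ℕ, disjoint collections C, U ⊂ D_j with H = C ∪ U, a dyadic interval L with halves L', L'' satisfying |C ∩ L'| = |C ∩ L''| = r and |U ∩ L'| = |U ∩ L''| = r, an (η,d)-homogeneous colouring {C_i} of C, and a colouring {U_i} of U, such that: the induced colourings of H ∩ L' and of H ∩ L'' (with H_i = C_i ∪ U_i) are each (η,d)-homogeneous, with |H_i ∩ K| = 1 for 1 ≤ i ≤ 2r and |H_i ∩ K| = 0 for 2r+1 ≤ i ≤ 3r for K = L', L''; yet the union colouring of H ∩ L satisfies |H_i ∩ L| = 2 for 1 ≤ i ≤ 2r and |H_i ∩ L| = 0 for 2r+1 ≤ i ≤ 3r, hence is not an (η,d)-homogeneous colouring of H ∩ L. Moreover, for the same C and the same colouring {C_i} of C, there exists a different colouring {U_i'} of U such that {C_i ∪ U_i'} is a (1/2, d)-homogeneous colouring of H ∩ L. -/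
/-- Encoding of dyadic intervals: an interval of `D_j` (the dyadic intervals of length
`2 ^ (-j)` in `[0,1]`) is encoded by its position `i < 2 ^ j`, representing
`[i / 2 ^ j, (i + 1) / 2 ^ j]`; a dyadic testing interval `L ∈ D` with `|L| ≥ 2 ^ (-j)` is
encoded by a scale `k ≤ j` and a position `m < 2 ^ k`, representing
`[m / 2 ^ k, (m + 1) / 2 ^ k]`.  For a collection `C ⊆ D_j`, `restrict j k m C` is the
subcollection `C ∩ L = {i ∈ C : i ⊆ L}` of elements of `C` contained in the testing
interval `L = [m / 2 ^ k, (m + 1) / 2 ^ k]`. -/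
def restrict (j k m : ℕ) (C : Finset ℕ) : Finset ℕ :=
  C.filter fun i => i / 2 ^ (j - k) = m

/-- `col` is a decomposition of `C` into `d` pairwise disjoint (possibly empty) classes. -/
def IsColouring (d : ℕ) (C : Finset ℕ) (col : Fin d → Finset ℕ) : Prop :=
  (∀ i, col i ⊆ C) ∧ (∀ i₁ i₂ : Fin d, i₁ ≠ i₂ → Disjoint (col i₁) (col i₂)) ∧
    ∀ x ∈ C, ∃ i, x ∈ col i

/-- `col` is an `(η, d)`-homogeneous colouring of `C ⊆ D_j`: it is a decomposition of `C`
into `d` pairwise disjoint classes such that for every dyadic testing interval `L` of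
length `≥ 2 ^ (-j)`, either `|C ∩ L| > d` and
`η * max_{1 ≤ i ≤ d} |C_i ∩ L| ≤ min_{1 ≤ i ≤ d} |C_i ∩ L|`, or else `|C ∩ L| ≤ d` and
`|C_i ∩ L| ≤ 1` for every `1 ≤ i ≤ d`. -/
def IsHomogeneous (j d : ℕ) (η : ℝ) (C : Finset ℕ) (col : Fin d → Finset ℕ) : Prop :=
  IsColouring d C col ∧
    ∀ k ≤ j, ∀ m < 2 ^ k,
      (d < (restrict j k m C).card ∧
        ∀ i₁ i₂ : Fin d,
          η * (restrict j k m (col i₁)).card ≤ ((restrict j k m (col i₂)).card : ℝ)) ∨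
      ((restrict j k m C).card ≤ d ∧ ∀ i : Fin d, (restrict j k m (col i)).card ≤ 1)

/-- `col` is an `(η, d)`-homogeneous colouring of `C ∩ L₀`, where
`L₀ = [m₀ / 2 ^ k₀, (m₀ + 1) / 2 ^ k₀]`: the restricted classes `C_i ∩ L₀` decompose
`C ∩ L₀`, and the homogeneity condition holds for every dyadic testing interval
contained in `L₀`. -/
def IsHomogeneousOn (j d : ℕ) (η : ℝ) (k₀ m₀ : ℕ) (C : Finset ℕ)
    (col : Fin d → Finset ℕ) : Prop :=
  IsColouring d (restrict j k₀ m₀ C) (fun i => restrict j k₀ m₀ (col i)) ∧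
    ∀ k, k₀ ≤ k → k ≤ j → ∀ m < 2 ^ k, m / 2 ^ (k - k₀) = m₀ →
      (d < (restrict j k m C).card ∧
        ∀ i₁ i₂ : Fin d,
          η * (restrict j k m (col i₁)).card ≤ ((restrict j k m (col i₂)).card : ℝ)) ∨
      ((restrict j k m C).card ≤ d ∧ ∀ i : Fin d, (restrict j k m (col i)).card ≤ 1)

theorem restrict_subset_restrict {j k₀ k m₀ m : ℕ} (h₀ : k₀ ≤ k) (hk : k ≤ j)
    (hm : m / 2 ^ (k - k₀) = m₀) (S : Finset ℕ) : restrict j k m S ⊆ restrict j k₀ m₀ S := by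
  intro x hx
  simp only [restrict, Finset.mem_filter] at hx ⊢
  refine ⟨hx.1, ?_⟩
  rw [← hm, ← hx.2, Nat.div_div_eq_div_mul, ← pow_add]
  congr 2
  omega

theorem IsColouring.restrict {d : ℕ} {C : Finset ℕ} {col : Fin d → Finset ℕ}
    (h : IsColouring d C col) (j k m : ℕ) :
    IsColouring d (restrict j k m C) fun i => restrict j k m (col i) := by
  refine ⟨fun i => Finset.filter_subset_filter _ (h.1 i),
    fun a b hab => Finset.disjoint_filter_filter (h.2.1 a b hab), fun x hx => ?_⟩
  obtain ⟨hxC, hxm⟩ := Finset.mem_filter.1 hx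
  obtain ⟨i, hi⟩ := h.2.2 x hxC
  exact ⟨i, Finset.mem_filter.2 ⟨hi, hxm⟩⟩

theorem IsColouring.union {d : ℕ} {C U : Finset ℕ} {colC colU : Fin d → Finset ℕ}
    (hC : IsColouring d C colC) (hU : IsColouring d U colU) (hCU : Disjoint C U) :
    IsColouring d (C ∪ U) fun i => colC i ∪ colU i := by
  refine ⟨fun i => Finset.union_subset_union (hC.1 i) (hU.1 i), fun a b hab => ?_, fun x hx => ?_⟩
  · simp only [Finset.disjoint_union_left, Finset.disjoint_union_right]
    exact ⟨⟨hC.2.1 a b hab, hCU.symm.mono (hU.1 a) (hC.1 b)⟩,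
      hCU.mono (hC.1 a) (hU.1 b), hU.2.1 a b hab⟩
  · rcases Finset.mem_union.1 hx with hx | hx
    · obtain ⟨i, hi⟩ := hC.2.2 x hx
      exact ⟨i, Finset.mem_union_left _ hi⟩
    · obtain ⟨i, hi⟩ := hU.2.2 x hx
      exact ⟨i, Finset.mem_union_right _ hi⟩

/-- If a testing interval contains at most `d` elements, of pairwise distinct colours, then the
colouring is homogeneous on that interval. -/
theorem IsColouring.isHomogeneousOn {j d k₀ m₀ : ℕ} {C : Finset ℕ} {col : Fin d → Finset ℕ}
    (h : IsColouring d C col) (η : ℝ) (hcard : (_root_.restrict j k₀ m₀ C).card ≤ d)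
    (hcol : ∀ i, (_root_.restrict j k₀ m₀ (col i)).card ≤ 1) :
    IsHomogeneousOn j d η k₀ m₀ C col :=
  ⟨h.restrict j k₀ m₀, fun _ h₀ hk _ _ hm => Or.inr
    ⟨(Finset.card_le_card (restrict_subset_restrict h₀ hk hm _)).trans hcard,
      fun i => (Finset.card_le_card (restrict_subset_restrict h₀ hk hm _)).trans (hcol i)⟩⟩

theorem IsColouring.isHomogeneous {j d : ℕ} {C : Finset ℕ} {col : Fin d → Finset ℕ}
    (h : IsColouring d C col) (η : ℝ) (hcard : C.card ≤ d) (hcol : ∀ i, (col i).card ≤ 1) :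
    IsHomogeneous j d η C col :=
  ⟨h, fun _ _ _ _ => Or.inr ⟨(Finset.card_filter_le _ _).trans hcard,
    fun i => (Finset.card_filter_le _ _).trans (hcol i)⟩⟩

theorem restrict_zero_zero {j : ℕ} {S : Finset ℕ} (hS : ∀ x ∈ S, x < 2 ^ j) :
    restrict j 0 0 S = S :=
  Finset.filter_true_of_mem fun x hx => Nat.div_eq_of_lt (by simpa using hS x hx)

theorem restrict_left_half (n : ℕ) (S : Finset ℕ) :
    restrict (n + 1) 1 0 S = S.filter (· < 2 ^ n) := by
  simp [restrict, Nat.div_eq_zero_iff]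

theorem restrict_right_half {n : ℕ} {S : Finset ℕ} (hS : ∀ x ∈ S, x < 2 ^ (n + 1)) :
    restrict (n + 1) 1 1 S = S.filter (2 ^ n ≤ ·) := by
  refine Finset.filter_congr fun x hx => ?_
  have := hS x hx
  rw [Nat.add_sub_cancel, Nat.div_eq_iff (by positivity)]
  rw [pow_succ] at this
  omega

/-- A colouring is homogeneous on `[0,1]` as soon as `[0,1]` itself satisfies the balance condition
and the colouring is homogeneous on both halves. -/
theorem IsColouring.isHomogeneousOn_of_halves {j d : ℕ} {η : ℝ} {C : Finset ℕ}
    {col : Fin d → Finset ℕ} (h : IsColouring d C col)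
    (hcard : d < (_root_.restrict j 0 0 C).card)
    (hbal : ∀ a b, η * (_root_.restrict j 0 0 (col a)).card ≤
      ((_root_.restrict j 0 0 (col b)).card : ℝ))
    (hl : IsHomogeneousOn j d η 1 0 C col) (hr : IsHomogeneousOn j d η 1 1 C col) :
    IsHomogeneousOn j d η 0 0 C col := by
  refine ⟨h.restrict j 0 0, fun k _ hk m hm _ => ?_⟩
  rcases Nat.eq_zero_or_pos k with rfl | hk0
  · obtain rfl : m = 0 := by simpa using hm
    exact Or.inl ⟨hcard, hbal⟩
  · have hlt : m / 2 ^ (k - 1) < 2 := by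
      rw [Nat.div_lt_iff_lt_mul (by positivity), ← pow_succ']
      rwa [Nat.sub_add_cancel hk0]
    rcases Nat.le_one_iff_eq_zero_or_eq_one.1 (Nat.le_of_lt_succ hlt) with h0 | h1
    · exact hl.2 k hk0 hk m hm h0
    · exact hr.2 k hk0 hk m hm h1

/-- The collection `C` of the example; the halves of `[0,1]` are split at position `N`. -/
def exampleC (r N : ℕ) : Finset ℕ := Finset.range r ∪ Finset.Ico (N + r) (N + 2 * r)

/-- The collection `U` of the example. -/
def exampleU (r N : ℕ) : Finset ℕ := Finset.Ico r (2 * r) ∪ Finset.Ico N (N + r)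

/-- The colouring of `exampleC r N` in which colour `i < 2 * r` is used exactly once. -/
def exampleColC (r N i : ℕ) : Finset ℕ :=
  if i < r then {i} else if i < 2 * r then {N + i} else ∅

/-- The colouring of `exampleU r N` that repeats the colours of `exampleColC r N`. -/
def exampleColU (r N i : ℕ) : Finset ℕ :=
  if i < r then {N + i} else if i < 2 * r then {i} else ∅

/-- The colouring of `exampleU r N` that uses the colours missing from `exampleColC r N`. -/
def exampleColU' (r N i : ℕ) : Finset ℕ :=
  if i < 2 * r then ∅ else {i - r, N + (i - 2 * r)}

theorem mem_exampleC {r N x : ℕ} :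
    x ∈ exampleC r N ↔ x < r ∨ N + r ≤ x ∧ x < N + 2 * r := by simp [exampleC]

theorem mem_exampleU {r N x : ℕ} :
    x ∈ exampleU r N ↔ r ≤ x ∧ x < 2 * r ∨ N ≤ x ∧ x < N + r := by simp [exampleU]

theorem mem_exampleColC {r N i x : ℕ} :
    x ∈ exampleColC r N i ↔ i < r ∧ x = i ∨ r ≤ i ∧ i < 2 * r ∧ x = N + i := by
  unfold exampleColC; split_ifs <;> simp <;> omega

theorem mem_exampleColU {r N i x : ℕ} :
    x ∈ exampleColU r N i ↔ i < r ∧ x = N + i ∨ r ≤ i ∧ i < 2 * r ∧ x = i := by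
  unfold exampleColU; split_ifs <;> simp <;> omega

theorem mem_exampleColU' {r N i x : ℕ} :
    x ∈ exampleColU' r N i ↔ 2 * r ≤ i ∧ (x = i - r ∨ x = N + (i - 2 * r)) := by
  unfold exampleColU'; split_ifs <;> simp <;> omega

theorem isColouring_exampleColC {r N : ℕ} (hN : 2 * r ≤ N) :
    IsColouring (3 * r) (exampleC r N) fun i => exampleColC r N i := by
  refine ⟨fun i x => ?_, fun a b hab => Finset.disjoint_left.2 fun x => ?_, fun x hx => ?_⟩
  · rw [mem_exampleC, mem_exampleColC]; omega
  · rw [mem_exampleColC, mem_exampleColC]; omega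
  · rw [mem_exampleC] at hx
    refine ⟨⟨if x < r then x else x - N, ?_⟩, ?_⟩
    · split_ifs <;> omega
    · simp only [mem_exampleColC]
      split_ifs <;> omega

theorem isColouring_exampleColU {r N : ℕ} (hN : 2 * r ≤ N) :
    IsColouring (3 * r) (exampleU r N) fun i => exampleColU r N i := by
  refine ⟨fun i x => ?_, fun a b hab => Finset.disjoint_left.2 fun x => ?_, fun x hx => ?_⟩
  · rw [mem_exampleU, mem_exampleColU]; omega
  · rw [mem_exampleColU, mem_exampleColU]; omega
  · rw [mem_exampleU] at hx
    refine ⟨⟨if x < N then x else x - N, ?_⟩, ?_⟩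
    · split_ifs <;> omega
    · simp only [mem_exampleColU]
      split_ifs <;> omega

theorem isColouring_exampleColU' {r N : ℕ} (hN : 2 * r ≤ N) :
    IsColouring (3 * r) (exampleU r N) fun i => exampleColU' r N i := by
  refine ⟨fun i x => ?_, fun a b hab => Finset.disjoint_left.2 fun x => ?_, fun x hx => ?_⟩
  · rw [mem_exampleU, mem_exampleColU']; omega
  · rw [mem_exampleColU', mem_exampleColU']; omega
  · rw [mem_exampleU] at hx
    refine ⟨⟨if x < N then x + r else x - N + 2 * r, ?_⟩, ?_⟩
    · split_ifs <;> omega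
    · simp only [mem_exampleColU']
      split_ifs <;> omega

theorem disjoint_exampleC_exampleU {r N : ℕ} (hN : 2 * r ≤ N) :
    Disjoint (exampleC r N) (exampleU r N) :=
  Finset.disjoint_left.2 fun x => by rw [mem_exampleC, mem_exampleU]; omega

theorem filter_lt_exampleC {r N : ℕ} (hN : 2 * r ≤ N) :
    (exampleC r N).filter (· < N) = Finset.range r := by
  ext x; simp only [Finset.mem_filter, mem_exampleC, Finset.mem_range]; omega

theorem filter_le_exampleC {r N : ℕ} (hN : 2 * r ≤ N) :
    (exampleC r N).filter (N ≤ ·) = Finset.Ico (N + r) (N + 2 * r) := by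
  ext x; simp only [Finset.mem_filter, mem_exampleC, Finset.mem_Ico]; omega

theorem filter_lt_exampleU {r N : ℕ} (hN : 2 * r ≤ N) :
    (exampleU r N).filter (· < N) = Finset.Ico r (2 * r) := by
  ext x; simp only [Finset.mem_filter, mem_exampleU, Finset.mem_Ico]; omega

theorem filter_le_exampleU {r N : ℕ} (hN : 2 * r ≤ N) :
    (exampleU r N).filter (N ≤ ·) = Finset.Ico N (N + r) := by
  ext x; simp only [Finset.mem_filter, mem_exampleU, Finset.mem_Ico]; omega

theorem filter_lt_exampleColC_union_exampleColU {r N : ℕ} (hN : 2 * r ≤ N) (i : ℕ) :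
    (exampleColC r N i ∪ exampleColU r N i).filter (· < N) = if i < 2 * r then {i} else ∅ := by
  ext x
  simp only [Finset.mem_filter, Finset.mem_union, mem_exampleColC, mem_exampleColU]
  split_ifs <;> simp <;> omega

theorem filter_le_exampleColC_union_exampleColU {r N : ℕ} (hN : 2 * r ≤ N) (i : ℕ) :
    (exampleColC r N i ∪ exampleColU r N i).filter (N ≤ ·) =
      if i < 2 * r then {N + i} else ∅ := by
  ext x
  simp only [Finset.mem_filter, Finset.mem_union, mem_exampleColC, mem_exampleColU]
  split_ifs <;> simp <;> omega

theorem card_exampleColC_union_exampleColU {r N : ℕ} (hN : 0 < N) (i : ℕ) :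
    (exampleColC r N i ∪ exampleColU r N i).card = if i < 2 * r then 2 else 0 := by
  split_ifs with h
  · rw [show exampleColC r N i ∪ exampleColU r N i = {i, N + i} by
      ext x
      simp only [Finset.mem_union, mem_exampleColC, mem_exampleColU, Finset.mem_insert,
        Finset.mem_singleton]
      omega]
    exact Finset.card_pair (by omega)
  · rw [Finset.card_eq_zero, Finset.eq_empty_iff_forall_notMem]
    intro x
    simp only [Finset.mem_union, mem_exampleColC, mem_exampleColU]
    omega

theorem card_filter_lt_exampleColC_union_exampleColU'_le_one {r N i : ℕ}
    (hi : i < 3 * r) : ((exampleColC r N i ∪ exampleColU' r N i).filter (· < N)).card ≤ 1 := by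
  refine Finset.card_le_one.2 fun a ha b hb => ?_
  simp only [Finset.mem_filter, Finset.mem_union, mem_exampleColC, mem_exampleColU'] at ha hb
  omega

theorem card_filter_le_exampleColC_union_exampleColU'_le_one {r N i : ℕ} (hN : 2 * r ≤ N)
    (hi : i < 3 * r) : ((exampleColC r N i ∪ exampleColU' r N i).filter (N ≤ ·)).card ≤ 1 := by
  refine Finset.card_le_one.2 fun a ha b hb => ?_
  simp only [Finset.mem_filter, Finset.mem_union, mem_exampleColC, mem_exampleColU'] at ha hb
  omega

theorem card_exampleColC_union_exampleColU' {r N i : ℕ} (hN : 2 * r ≤ N) (hi : i < 3 * r) :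
    (exampleColC r N i ∪ exampleColU' r N i).card = if i < 2 * r then 1 else 2 := by
  split_ifs with h
  · rw [exampleColU', if_pos h, Finset.union_empty, exampleColC]
    split_ifs <;> simp
  · rw [exampleColU', if_neg h, exampleColC, if_neg (by omega), if_neg h, Finset.empty_union]
    exact Finset.card_pair (by omega)

/-- **Example: separate homogeneous colourings of the two halves need not unite.**
Let `r ∈ ℕ`, `d = 3r`, `0 < η ≤ 1/2`.  There exist `j ∈ ℕ`, disjoint collections
`C, U ⊆ D_j` with `H = C ∪ U`, a dyadic interval `L` (of scale `k`, position `m`) with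
halves `L'` (position `2m`) and `L''` (position `2m + 1`) satisfying
`|C ∩ L'| = |C ∩ L''| = r` and `|U ∩ L'| = |U ∩ L''| = r`, an `(η, d)`-homogeneous
colouring `{C_i}` of `C` and a colouring `{U_i}` of `U` such that: the induced colourings
of `H ∩ L'` and `H ∩ L''` (with `H_i = C_i ∪ U_i`) are each `(η, d)`-homogeneous, with
`|H_i ∩ K| = 1` for `1 ≤ i ≤ 2r` and `|H_i ∩ K| = 0` for `2r + 1 ≤ i ≤ 3r`, `K = L', L''`
(colour `i.val + 1` for `i : Fin (3r)`); yet the union colouring of `H ∩ L` satisfies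
`|H_i ∩ L| = 2` for `1 ≤ i ≤ 2r` and `|H_i ∩ L| = 0` for `2r + 1 ≤ i ≤ 3r`, hence is not
an `(η, d)`-homogeneous colouring of `H ∩ L`.  Moreover, for the same `C` and the same
colouring `{C_i}`, a different colouring `{U_i'}` of `U` makes `{C_i ∪ U_i'}` a
`(1/2, d)`-homogeneous colouring of `H ∩ L`. -/
theorem separate_homogeneous_halves_union_fails (r : ℕ) (hr : 0 < r)
    (η : ℝ) (hη0 : 0 < η) (hη : η ≤ 1 / 2) :
    ∃ (j : ℕ) (C U : Finset ℕ) (k m : ℕ),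
      (∀ x ∈ C, x < 2 ^ j) ∧ (∀ x ∈ U, x < 2 ^ j) ∧ Disjoint C U ∧
      k + 1 ≤ j ∧ m < 2 ^ k ∧
      (restrict j (k + 1) (2 * m) C).card = r ∧
      (restrict j (k + 1) (2 * m + 1) C).card = r ∧
      (restrict j (k + 1) (2 * m) U).card = r ∧
      (restrict j (k + 1) (2 * m + 1) U).card = r ∧
      ∃ colC colU : Fin (3 * r) → Finset ℕ,
        IsHomogeneous j (3 * r) η C colC ∧
        IsColouring (3 * r) U colU ∧
        IsHomogeneousOn j (3 * r) η (k + 1) (2 * m) (C ∪ U)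
          (fun i => colC i ∪ colU i) ∧
        IsHomogeneousOn j (3 * r) η (k + 1) (2 * m + 1) (C ∪ U)
          (fun i => colC i ∪ colU i) ∧
        (∀ i : Fin (3 * r), ∀ m' : ℕ, (m' = 2 * m ∨ m' = 2 * m + 1) →
          (restrict j (k + 1) m' (colC i ∪ colU i)).card =
            if i.val < 2 * r then 1 else 0) ∧
        (∀ i : Fin (3 * r),
          (restrict j k m (colC i ∪ colU i)).card = if i.val < 2 * r then 2 else 0) ∧
        ¬ IsHomogeneousOn j (3 * r) η k m (C ∪ U) (fun i => colC i ∪ colU i) ∧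
        ∃ colU' : Fin (3 * r) → Finset ℕ,
          IsColouring (3 * r) U colU' ∧ colU' ≠ colU ∧
          IsHomogeneousOn j (3 * r) (1 / 2) k m (C ∪ U)
            (fun i => colC i ∪ colU' i) := by
  obtain ⟨n, hN⟩ : ∃ n, 2 * r ≤ 2 ^ n := ⟨2 * r, Nat.lt_two_pow_self.le⟩
  have hpow : 2 ^ (n + 1) = 2 * 2 ^ n := pow_succ' 2 n
  have hCU := disjoint_exampleC_exampleU hN
  have hC := isColouring_exampleColC hN
  have hU := isColouring_exampleColU hN
  have hU' := isColouring_exampleColU' hN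
  have hH := hC.union hU hCU
  have hH' := hC.union hU' hCU
  have hCj : ∀ x ∈ exampleC r (2 ^ n), x < 2 ^ (n + 1) := fun x hx => by
    rw [mem_exampleC] at hx; omega
  have hUj : ∀ x ∈ exampleU r (2 ^ n), x < 2 ^ (n + 1) := fun x hx => by
    rw [mem_exampleU] at hx; omega
  have hHj : ∀ x ∈ exampleC r (2 ^ n) ∪ exampleU r (2 ^ n), x < 2 ^ (n + 1) := fun x hx =>
    (Finset.mem_union.1 hx).elim (hCj x) (hUj x)
  have hij (i : Fin (3 * r)) := fun x hx => hHj x (hH.1 i hx)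
  have hij' (i : Fin (3 * r)) := fun x hx => hHj x (hH'.1 i hx)
  have hCl : (restrict (n + 1) 1 0 (exampleC r (2 ^ n))).card = r := by
    rw [restrict_left_half, filter_lt_exampleC hN, Finset.card_range]
  have hCr : (restrict (n + 1) 1 1 (exampleC r (2 ^ n))).card = r := by
    rw [restrict_right_half hCj, filter_le_exampleC hN, Nat.card_Ico]; omega
  have hUl : (restrict (n + 1) 1 0 (exampleU r (2 ^ n))).card = r := by
    rw [restrict_left_half, filter_lt_exampleU hN, Nat.card_Ico]; omega
  have hUr : (restrict (n + 1) 1 1 (exampleU r (2 ^ n))).card = r := by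
    rw [restrict_right_half hUj, filter_le_exampleU hN, Nat.card_Ico]; omega
  have hHm (m : ℕ) : (restrict (n + 1) 1 m (exampleC r (2 ^ n) ∪ exampleU r (2 ^ n))).card ≤
      (restrict (n + 1) 1 m (exampleC r (2 ^ n))).card +
        (restrict (n + 1) 1 m (exampleU r (2 ^ n))).card := by
    rw [restrict, Finset.filter_union]
    exact Finset.card_union_le _ _
  have hHl := (hHm 0).trans (by omega : _ ≤ 3 * r)
  have hHr := (hHm 1).trans (by omega : _ ≤ 3 * r)
  have hcardC : (exampleC r (2 ^ n)).card = 2 * r := by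
    rw [exampleC, Finset.card_union_of_disjoint, Finset.card_range, Nat.card_Ico]
    · omega
    · exact Finset.disjoint_left.2 fun x => by rw [Finset.mem_range, Finset.mem_Ico]; omega
  have hcardU : (exampleU r (2 ^ n)).card = 2 * r := by
    rw [exampleU, Finset.card_union_of_disjoint, Nat.card_Ico, Nat.card_Ico]
    · omega
    · exact Finset.disjoint_left.2 fun x => by rw [Finset.mem_Ico, Finset.mem_Ico]; omega
  have hcardH : 3 * r < (restrict (n + 1) 0 0 (exampleC r (2 ^ n) ∪ exampleU r (2 ^ n))).card := by
    rw [restrict_zero_zero hHj, Finset.card_union_of_disjoint hCU]; omega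
  have hl (i : Fin (3 * r)) :
      (restrict (n + 1) 1 0 (exampleColC r (2 ^ n) i ∪ exampleColU r (2 ^ n) i)).card =
        if i.val < 2 * r then 1 else 0 := by
    rw [restrict_left_half, filter_lt_exampleColC_union_exampleColU hN]
    split_ifs <;> simp
  have hr' (i : Fin (3 * r)) :
      (restrict (n + 1) 1 1 (exampleColC r (2 ^ n) i ∪ exampleColU r (2 ^ n) i)).card =
        if i.val < 2 * r then 1 else 0 := by
    rw [restrict_right_half (hij i), filter_le_exampleColC_union_exampleColU hN]
    split_ifs <;> simp
  have htot (i : Fin (3 * r)) :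
      (restrict (n + 1) 0 0 (exampleColC r (2 ^ n) i ∪ exampleColU r (2 ^ n) i)).card =
        if i.val < 2 * r then 2 else 0 := by
    rw [restrict_zero_zero (hij i), card_exampleColC_union_exampleColU (by positivity)]
  refine ⟨n + 1, exampleC r (2 ^ n), exampleU r (2 ^ n), 0, 0, hCj, hUj, hCU, by omega,
    by norm_num, hCl, hCr, hUl, hUr, fun i => exampleColC r (2 ^ n) i,
    fun i => exampleColU r (2 ^ n) i, hC.isHomogeneous η (by omega) fun i => ?_, hU,
    hH.isHomogeneousOn η hHl fun i => ?_, hH.isHomogeneousOn η hHr fun i => ?_, ?_, htot, ?_,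
    fun i => exampleColU' r (2 ^ n) i, hU', fun heq => ?_,
    hH'.isHomogeneousOn_of_halves hcardH (fun a b => ?_)
      (hH'.isHomogeneousOn _ hHl fun i => ?_) (hH'.isHomogeneousOn _ hHr fun i => ?_)⟩
  · simp only [exampleColC]
    split_ifs <;> simp
  · rw [hl i]
    split_ifs <;> simp
  · rw [hr' i]
    split_ifs <;> simp
  · rintro i m' (rfl | rfl)
    · exact hl i
    · exact hr' i
  · intro h
    rcases h.2 0 le_rfl (by omega) 0 (by norm_num) rfl with ⟨_, h⟩ | ⟨h, _⟩
    · have := h ⟨0, by omega⟩ ⟨2 * r, by omega⟩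
      rw [htot, htot, if_pos (by simpa using hr), if_neg (by simp)] at this
      push_cast at this
      linarith
    · omega
  · have := congrFun heq ⟨0, by omega⟩
    simp [exampleColU, exampleColU', hr] at this
  · rw [restrict_zero_zero (hij' a), restrict_zero_zero (hij' b),
      card_exampleColC_union_exampleColU' hN a.2, card_exampleColC_union_exampleColU' hN b.2]
    split_ifs <;> norm_num
  · rw [restrict_left_half]
    exact card_filter_lt_exampleColC_union_exampleColU'_le_one i.2
  · rw [restrict_right_half (hij' i)]
    exact card_filter_le_exampleColC_union_exampleColU'_le_one hN i.2
end

section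
/- Let 1 ≤ k ≤ n-1, and let {C_i(k-1)} be the (1/n, d)-homogeneous colouring of C(k-1) given by C_1(k-1) = {J_{n-k+2}, …, J_{n+1}} and C_i(k-1) = {I_{i-1}} for 2 ≤ i ≤ d. Then there exists exactly one (1/n, d)-homogeneous colouring {C_i(k)} of C(k) satisfying C_i(k-1) ⊆ C_i(k) for all 1 ≤ i ≤ d, namely C_1(k) = {J_{n-k+1}, …, J_{n+1}} and C_i(k) = {I_{i-1}} for 2 ≤ i ≤ d. -/
/- Setup for the counterexample of Section 3 (with `d = 2 ^ a`, `η = 1 / n`,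
`j ≥ n + a + 1`): a chain of dyadic intervals `L_1 ⊂ L_2 ⊂ … ⊂ L_{n+2}` with
`L_i ∈ D_{j-a-i+1}` (so `L i` is the position of `L_i` at scale `j + 1 - (a + i)`, and
`L_i ⊂ L_{i+1}` reads `L (i+1) = L i / 2`); `P_i = L_{i+1} \ L_i` is the dyadic brother
of `L_i` in `L_{i+1}` (same scale as `L_i`, same parent, different position); pairwise
distinct `I_1, …, I_{d-1} ∈ D_j` with `I_i ⊆ L_1` (i.e. `I i / 2 ^ a = L 1`), and
`J_1, …, J_{n+1} ∈ D_j` with `J_i ⊆ P_i` (i.e. `J i / 2 ^ (a + i - 1) = P i`).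
For `0 ≤ k ≤ n`, `C(k) = {I_1, …, I_{d-1}} ∪ {J_{n-k+1}, …, J_{n+1}}` is encoded as
`(Finset.Icc 1 (2 ^ a - 1)).image I ∪ (Finset.Icc (n + 1 - k) (n + 1)).image J`.
Colour classes are indexed by `i : Fin (2 ^ a)`, index `i` corresponding to colour
`i.val + 1 ∈ {1, …, d}`. -/

theorem restrict_union (j k m : ℕ) (A B : Finset ℕ) :
    restrict j k m (A ∪ B) = restrict j k m A ∪ restrict j k m B :=
  Finset.filter_union _ _ _

theorem card_restrict_le (j k m : ℕ) (A : Finset ℕ) : (restrict j k m A).card ≤ A.card :=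
  Finset.card_filter_le _ _

theorem mem_restrict {j k m : ℕ} {A : Finset ℕ} {x : ℕ} :
    x ∈ restrict j k m A ↔ x ∈ A ∧ x / 2 ^ (j - k) = m :=
  Finset.mem_filter

/-- Two positions with the same ancestor at some scale have the same ancestor at every
coarser scale. -/
theorem div_two_pow_eq_of_le {x y e f : ℕ} (hef : e ≤ f) (h : x / 2 ^ e = y / 2 ^ e) :
    x / 2 ^ f = y / 2 ^ f := by
  obtain ⟨g, rfl⟩ := Nat.exists_eq_add_of_le hef
  rw [pow_add, ← Nat.div_div_eq_div_mul, ← Nat.div_div_eq_div_mul, h]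

/-- Halving passes from the scale of `L_s` to the scale of `L_{s+1}`. -/
theorem div_two_pow_succ_scale (x a s : ℕ) (hs : 1 ≤ s) :
    x / 2 ^ (a + (s + 1) - 1) = x / 2 ^ (a + s - 1) / 2 := by
  rw [Nat.div_div_eq_div_mul, ← pow_succ]
  congr 2
  omega

/-- The colouring with one class `B` and all other classes singletons `{I i}` is homogeneous,
provided that a testing interval containing two points of `B` contains every `I i`. -/
theorem isHomogeneous_of_forall_mem {d n j : ℕ} (hn : 1 ≤ n) {I : ℕ → ℕ} {B : Finset ℕ}
    (hd : 1 ≤ d) (hInj : Set.InjOn I (Finset.Icc 1 (d - 1)))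
    (hdisj : Disjoint ((Finset.Icc 1 (d - 1)).image I) B) (hB : B.card ≤ n)
    (hmem : ∀ x ∈ B, ∀ y ∈ B, x ≠ y → ∀ e, x / 2 ^ e = y / 2 ^ e →
      ∀ t ∈ Finset.Icc 1 (d - 1), I t / 2 ^ e = x / 2 ^ e) :
    IsHomogeneous j d (1 / (n : ℝ)) ((Finset.Icc 1 (d - 1)).image I ∪ B)
      (fun i : Fin d => if i.val = 0 then B else {I i.val}) := by
  have hIcc (i : Fin d) (hi : i.val ≠ 0) : i.val ∈ Finset.Icc 1 (d - 1) := by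
    have := i.isLt
    simp only [Finset.mem_Icc]
    omega
  have hIB (i : Fin d) (hi : i.val ≠ 0) : I i.val ∉ B :=
    Finset.disjoint_left.mp hdisj (Finset.mem_image_of_mem I (hIcc i hi))
  refine ⟨⟨fun i => ?_, fun i₁ i₂ hne => ?_, fun x hx => ?_⟩, fun k _ m _ => ?_⟩
  · dsimp only
    split_ifs with hi
    · exact Finset.subset_union_right
    · exact Finset.singleton_subset_iff.mpr
        (Finset.mem_union_left _ (Finset.mem_image_of_mem I (hIcc i hi)))
  · dsimp only
    split_ifs with h₁ h₂ h₂
    · exact absurd (Fin.ext (h₁.trans h₂.symm)) hne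
    · exact Finset.disjoint_singleton_right.mpr (hIB i₂ h₂)
    · exact Finset.disjoint_singleton_left.mpr (hIB i₁ h₁)
    · rw [Finset.disjoint_singleton]
      exact fun h => hne (Fin.ext (hInj (hIcc i₁ h₁) (hIcc i₂ h₂) h))
  · rcases Finset.mem_union.mp hx with hx | hx
    · obtain ⟨t, ht, rfl⟩ := Finset.mem_image.mp hx
      rw [Finset.mem_Icc] at ht
      refine ⟨⟨t, by omega⟩, ?_⟩
      simp [show t ≠ 0 by omega]
    · exact ⟨⟨0, hd⟩, by simpa using hx⟩
  · have hcardI : ((Finset.Icc 1 (d - 1)).image I).card = d - 1 := by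
      rw [Finset.card_image_of_injOn hInj, Nat.card_Icc]
      omega
    have hcard : (restrict j k m ((Finset.Icc 1 (d - 1)).image I ∪ B)).card =
        (restrict j k m ((Finset.Icc 1 (d - 1)).image I)).card + (restrict j k m B).card := by
      rw [restrict_union, Finset.card_union_of_disjoint]
      exact hdisj.mono (Finset.filter_subset _ _) (Finset.filter_subset _ _)
    have hle := card_restrict_le j k m ((Finset.Icc 1 (d - 1)).image I)
    rcases Nat.lt_or_ge 1 (restrict j k m B).card with hlt | hge
    · left
      obtain ⟨x, hx, y, hy, hxy⟩ := Finset.one_lt_card.mp hlt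
      rw [mem_restrict] at hx hy
      have hall (t : ℕ) (ht : t ∈ Finset.Icc 1 (d - 1)) : I t / 2 ^ (j - k) = m :=
        (hmem x hx.1 y hy.1 hxy _ (hx.2.trans hy.2.symm) t ht).trans hx.2
      have hIall : restrict j k m ((Finset.Icc 1 (d - 1)).image I) =
          (Finset.Icc 1 (d - 1)).image I := by
        refine Finset.filter_true_of_mem fun z hz => ?_
        obtain ⟨t, ht, rfl⟩ := Finset.mem_image.mp hz
        exact hall t ht
      have hBle := card_restrict_le j k m B
      have hbounds (i : Fin d) :
          (restrict j k m (if i.val = 0 then B else {I i.val})).card ≤ n ∧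
            1 ≤ (restrict j k m (if i.val = 0 then B else {I i.val})).card := by
        split_ifs with hi
        · omega
        · have : restrict j k m {I i.val} = {I i.val} :=
            Finset.filter_true_of_mem fun z hz => by
              rw [Finset.mem_singleton.mp hz]
              exact hall _ (hIcc i hi)
          rw [this, Finset.card_singleton]
          omega
      refine ⟨?_, fun i₁ i₂ => ?_⟩
      · rw [hcard, hIall, hcardI]
        omega
      · have hn0 : (0 : ℝ) < n := by exact_mod_cast hn
        have h₁ : ((restrict j k m (if i₁.val = 0 then B else {I i₁.val})).card : ℝ) ≤ n := by
          exact_mod_cast (hbounds i₁).1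
        have h₂ :
            (1 : ℝ) ≤ (restrict j k m (if i₂.val = 0 then B else {I i₂.val})).card := by
          exact_mod_cast (hbounds i₂).2
        refine le_trans ?_ h₂
        rw [one_div, inv_mul_le_iff₀ hn0, mul_one]
        exact h₁
    · right
      refine ⟨by omega, fun i => ?_⟩
      dsimp only
      split_ifs
      · exact hge
      · exact (card_restrict_le j k m _).trans (Finset.card_singleton _).le

/-- **Stage `k`, `1 ≤ k ≤ n - 1`: unique consistent extension.**
Let `{C_i(k-1)}` be the `(1/n, d)`-homogeneous colouring of `C(k-1)` given by
`C_1(k-1) = {J_{n-k+2}, …, J_{n+1}}` and `C_i(k-1) = {I_{i-1}}` for `2 ≤ i ≤ d`.  Then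
there exists exactly one `(1/n, d)`-homogeneous colouring `{C_i(k)}` of `C(k)` with
`C_i(k-1) ⊆ C_i(k)` for all `1 ≤ i ≤ d`, namely `C_1(k) = {J_{n-k+1}, …, J_{n+1}}` and
`C_i(k) = {I_{i-1}}` for `2 ≤ i ≤ d`. -/
theorem unique_consistent_extension
    (a n j : ℕ) (hn : 1 ≤ n) (hj : n + a + 1 ≤ j)
    (L P I J : ℕ → ℕ)
    (hL : ∀ i, 1 ≤ i → i ≤ n + 2 → L i < 2 ^ (j + 1 - (a + i)))
    (hchain : ∀ i, 1 ≤ i → i ≤ n + 1 → L (i + 1) = L i / 2)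
    (hP : ∀ i, 1 ≤ i → i ≤ n + 1 → P i / 2 = L i / 2 ∧ P i ≠ L i)
    (hI : ∀ i, 1 ≤ i → i ≤ 2 ^ a - 1 → I i < 2 ^ j ∧ I i / 2 ^ a = L 1)
    (hInj : ∀ i₁ i₂, 1 ≤ i₁ → i₁ ≤ 2 ^ a - 1 → 1 ≤ i₂ → i₂ ≤ 2 ^ a - 1 →
      I i₁ = I i₂ → i₁ = i₂)
    (hJ : ∀ i, 1 ≤ i → i ≤ n + 1 → J i < 2 ^ j ∧ J i / 2 ^ (a + i - 1) = P i)
    (k : ℕ) (hk1 : 1 ≤ k) (hk : k ≤ n - 1) :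
    (IsHomogeneous j (2 ^ a) (1 / (n : ℝ))
        ((Finset.Icc 1 (2 ^ a - 1)).image I ∪ (Finset.Icc (n + 1 - k) (n + 1)).image J)
        (fun i : Fin (2 ^ a) =>
          if i.val = 0 then (Finset.Icc (n + 1 - k) (n + 1)).image J else {I i.val}) ∧
      (∀ i : Fin (2 ^ a),
        (if i.val = 0 then (Finset.Icc (n + 2 - k) (n + 1)).image J
          else ({I i.val} : Finset ℕ)) ⊆
        (if i.val = 0 then (Finset.Icc (n + 1 - k) (n + 1)).image J else {I i.val}))) ∧
    ∀ col : Fin (2 ^ a) → Finset ℕ,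
      IsHomogeneous j (2 ^ a) (1 / (n : ℝ))
        ((Finset.Icc 1 (2 ^ a - 1)).image I ∪ (Finset.Icc (n + 1 - k) (n + 1)).image J)
        col →
      (∀ i : Fin (2 ^ a),
        (if i.val = 0 then (Finset.Icc (n + 2 - k) (n + 1)).image J
          else ({I i.val} : Finset ℕ)) ⊆ col i) →
      col = fun i : Fin (2 ^ a) =>
        if i.val = 0 then (Finset.Icc (n + 1 - k) (n + 1)).image J else {I i.val} := by
  have hd : 1 ≤ 2 ^ a := Nat.one_le_two_pow
  have hIL : ∀ s, 1 ≤ s → s ≤ n + 2 → ∀ t ∈ Finset.Icc 1 (2 ^ a - 1),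
      I t / 2 ^ (a + s - 1) = L s := by
    intro s hs
    induction s, hs using Nat.le_induction with
    | base =>
      intro _ t ht
      rw [Finset.mem_Icc] at ht
      simpa using (hI t ht.1 ht.2).2
    | succ s hs ih =>
      intro hs' t ht
      rw [div_two_pow_succ_scale _ _ _ hs, ih (by omega) t ht, hchain s hs (by omega)]
  have hJL : ∀ i, 1 ≤ i → ∀ s, i + 1 ≤ s → s ≤ n + 2 → J i / 2 ^ (a + s - 1) = L s := by
    intro i hi s hs
    induction s, hs using Nat.le_induction with
    | base =>
      intro hs'
      rw [div_two_pow_succ_scale _ _ _ hi, (hJ i hi (by omega)).2, (hP i hi (by omega)).1,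
        hchain i hi (by omega)]
    | succ s hs ih =>
      intro hs'
      rw [div_two_pow_succ_scale _ _ _ (by omega), ih (by omega),
        hchain s (by omega) (by omega)]
  have hJne : ∀ i, 1 ≤ i → i ≤ n + 1 → ∀ x e, e ≤ a + i - 1 →
      x / 2 ^ (a + i - 1) = L i → J i / 2 ^ e ≠ x / 2 ^ e := by
    intro i hi hi' x e he hx h
    have := div_two_pow_eq_of_le he h
    rw [(hJ i hi hi').2, hx] at this
    exact (hP i hi hi').2 this
  have hJI (i : ℕ) (hi : 1 ≤ i) (hi' : i ≤ n + 1) (t : ℕ) (ht : t ∈ Finset.Icc 1 (2 ^ a - 1)) :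
      J i ≠ I t := fun h =>
    hJne i hi hi' (I t) 0 (by omega) (hIL i hi (by omega) t ht) (by rw [h])
  have hmeet : ∀ p q, 1 ≤ p → p < q → q ≤ n + 1 → ∀ e, J p / 2 ^ e = J q / 2 ^ e →
      ∀ t ∈ Finset.Icc 1 (2 ^ a - 1), I t / 2 ^ e = J q / 2 ^ e := by
    intro p q hp hpq hq e he t ht
    have hle : a + (q + 1) - 1 ≤ e := by
      by_contra hlt
      exact hJne q (by omega) hq (J p) e (by omega) (hJL p hp q hpq (by omega)) he.symm
    exact div_two_pow_eq_of_le hle ((hIL (q + 1) (by omega) (by omega) t ht).trans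
      (hJL q (by omega) (q + 1) le_rfl (by omega)).symm)
  have hdisj : Disjoint ((Finset.Icc 1 (2 ^ a - 1)).image I)
      ((Finset.Icc (n + 1 - k) (n + 1)).image J) := by
    rw [Finset.disjoint_left]
    rintro x hx hx'
    obtain ⟨t, ht, rfl⟩ := Finset.mem_image.mp hx
    obtain ⟨i, hi, h⟩ := Finset.mem_image.mp hx'
    rw [Finset.mem_Icc] at hi
    exact hJI i (by omega) hi.2 t ht h
  refine ⟨⟨isHomogeneous_of_forall_mem hn hd ?_ hdisj ?_ ?_, fun i => ?_⟩, ?_⟩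
  · intro s hs t ht h
    rw [Finset.mem_coe, Finset.mem_Icc] at hs ht
    exact hInj s t hs.1 hs.2 ht.1 ht.2 h
  · refine Finset.card_image_le.trans ?_
    rw [Nat.card_Icc]
    omega
  · intro x hx y hy hxy e he t ht
    obtain ⟨p, hp, rfl⟩ := Finset.mem_image.mp hx
    obtain ⟨q, hq, rfl⟩ := Finset.mem_image.mp hy
    rw [Finset.mem_Icc] at hp hq
    rcases lt_trichotomy p q with h | rfl | h
    · exact (hmeet p q (by omega) h hq.2 e he t ht).trans he.symm
    · exact absurd rfl hxy
    · exact hmeet q p (by omega) h hp.2 e he.symm t ht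
  · split_ifs
    · exact Finset.image_subset_image (Finset.Icc_subset_Icc (by omega) le_rfl)
    · exact subset_rfl
  · rintro col ⟨⟨hsub, hcdisj, hcov⟩, hhom⟩ hext
    have hIcol (i : Fin (2 ^ a)) (hi : i.val ≠ 0) : I i.val ∈ col i := by
      simpa [hi] using hext i
    have hIcc (i : Fin (2 ^ a)) (hi : i.val ≠ 0) : i.val ∈ Finset.Icc 1 (2 ^ a - 1) := by
      have := i.isLt
      simp only [Finset.mem_Icc]
      omega
    have hnew : J (n + 1 - k) ∈ col ⟨0, hd⟩ := by
      obtain ⟨i, hi⟩ := hcov (J (n + 1 - k)) (Finset.mem_union_right _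
        (Finset.mem_image_of_mem J (Finset.mem_Icc.mpr ⟨le_rfl, by omega⟩)))
      by_cases hi0 : i.val = 0
      · rwa [show i = ⟨0, hd⟩ from Fin.ext hi0] at hi
      exfalso
      -- Test against `L_{n-k+2}`, which contains exactly `d` elements of the collection.
      have hscale : j - (j + 1 - (a + (n + 2 - k))) = a + (n + 2 - k) - 1 := by omega
      have hJmem := hJL (n + 1 - k) (by omega) (n + 2 - k) (by omega) (by omega)
      have hImem := hIL (n + 2 - k) (by omega) (by omega) _ (hIcc i hi0)
      have hcol : 1 < (restrict j (j + 1 - (a + (n + 2 - k))) (L (n + 2 - k)) (col i)).card :=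
        Finset.one_lt_card.mpr ⟨J (n + 1 - k), mem_restrict.mpr ⟨hi, by rw [hscale, hJmem]⟩,
          I i.val, mem_restrict.mpr ⟨hIcol i hi0, by rw [hscale, hImem]⟩,
          hJI _ (by omega) (by omega) _ (hIcc i hi0)⟩
      rcases hhom (j + 1 - (a + (n + 2 - k))) (by omega) (L (n + 2 - k))
        (hL _ (by omega) (by omega)) with ⟨hbig, -⟩ | ⟨-, hsmall⟩
      · have hJsub : restrict j (j + 1 - (a + (n + 2 - k))) (L (n + 2 - k))
            ((Finset.Icc (n + 1 - k) (n + 1)).image J) ⊆ {J (n + 1 - k)} := by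
          intro x hx
          rw [mem_restrict, hscale] at hx
          obtain ⟨q, hq, rfl⟩ := Finset.mem_image.mp hx.1
          rw [Finset.mem_Icc] at hq
          rcases hq.1.eq_or_lt with rfl | hlt
          · exact Finset.mem_singleton_self _
          · exact absurd (hx.2.trans hJmem.symm) (hJne q (by omega) hq.2 _ _ (by omega)
              (hJL (n + 1 - k) (by omega) q hlt (by omega)))
        have h₁ := Finset.card_le_card hJsub
        have h₂ := card_restrict_le j (j + 1 - (a + (n + 2 - k))) (L (n + 2 - k))
          ((Finset.Icc 1 (2 ^ a - 1)).image I)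
        have h₃ : ((Finset.Icc 1 (2 ^ a - 1)).image I).card ≤ _ := Finset.card_image_le
        have h₄ := Finset.card_union_le
          (restrict j (j + 1 - (a + (n + 2 - k))) (L (n + 2 - k))
            ((Finset.Icc 1 (2 ^ a - 1)).image I))
          (restrict j (j + 1 - (a + (n + 2 - k))) (L (n + 2 - k))
            ((Finset.Icc (n + 1 - k) (n + 1)).image J))
        rw [← restrict_union] at h₄
        rw [Nat.card_Icc] at h₃
        rw [Finset.card_singleton] at h₁
        omega
      · exact absurd (hsmall i) (by omega)
    have hincl (i : Fin (2 ^ a)) :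
        (if i.val = 0 then (Finset.Icc (n + 1 - k) (n + 1)).image J
          else ({I i.val} : Finset ℕ)) ⊆ col i := by
      by_cases hi : i.val = 0
      · have hi' : i = ⟨0, hd⟩ := Fin.ext hi
        subst hi'
        intro x hx
        rw [if_pos rfl] at hx
        obtain ⟨q, hq, rfl⟩ := Finset.mem_image.mp hx
        rw [Finset.mem_Icc] at hq
        rcases hq.1.eq_or_lt with rfl | hlt
        · exact hnew
        · refine hext ⟨0, hd⟩ ?_
          rw [if_pos rfl]
          exact Finset.mem_image_of_mem J (Finset.mem_Icc.mpr ⟨by omega, hq.2⟩)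
      · simpa [hi] using hIcol i hi
    funext i
    refine Finset.Subset.antisymm (fun x hx => ?_) (hincl i)
    have hcover : ∃ i' : Fin (2 ^ a),
        x ∈ (if i'.val = 0 then (Finset.Icc (n + 1 - k) (n + 1)).image J
          else ({I i'.val} : Finset ℕ)) := by
      rcases Finset.mem_union.mp (hsub i hx) with hx | hx
      · obtain ⟨t, ht, rfl⟩ := Finset.mem_image.mp hx
        rw [Finset.mem_Icc] at ht
        refine ⟨⟨t, by omega⟩, ?_⟩
        simp [show t ≠ 0 by omega]
      · exact ⟨⟨0, hd⟩, by simpa using hx⟩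
    obtain ⟨i', hi'⟩ := hcover
    have : i = i' := by
      by_contra hne
      exact Finset.disjoint_left.mp (hcdisj i i' hne) hx (hincl i' hi')
    rwa [this]
end

section
/- For every 0 ≤ k ≤ n-1, the pair of collections (C(k), U(k)), where U(k) = C(k+1) \ C(k) = {J_{n-k}}, is NOT d-previsible. -/
/-- The pair `(C, U)` of (disjoint) collections in `D_j` is `d`-previsible: for every dyadic
interval `L` of length `≥ 2 ^ (-(j - 1))` with immediate dyadic successors `L'`, `L''`
(the two halves of `L`, in either order), the conditions `|(C ∪ U) ∩ L'| < d` and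
`|(C ∪ U) ∩ L''| ≥ d` imply `U ∩ L'' = ∅` or `C ∩ L'' = ∅`. -/
def Previsible (j d : ℕ) (C U : Finset ℕ) : Prop :=
  ∀ k, k + 1 ≤ j → ∀ m < 2 ^ k, ∀ m' m'' : ℕ,
    (m' = 2 * m ∧ m'' = 2 * m + 1) ∨ (m' = 2 * m + 1 ∧ m'' = 2 * m) →
    (restrict j (k + 1) m' (C ∪ U)).card < d →
    d ≤ (restrict j (k + 1) m'' (C ∪ U)).card →
    restrict j (k + 1) m'' U = ∅ ∨ restrict j (k + 1) m'' C = ∅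

/- Setup for the counterexample of Section 3 (with `d = 2 ^ a`, `η = 1 / n`,
`j ≥ n + a + 1`): a chain of dyadic intervals `L_1 ⊂ L_2 ⊂ … ⊂ L_{n+2}` with
`L_i ∈ D_{j-a-i+1}` (so `L i` is the position of `L_i` at scale `j + 1 - (a + i)`, and
`L_i ⊂ L_{i+1}` reads `L (i+1) = L i / 2`); `P_i = L_{i+1} \ L_i` is the dyadic brother
of `L_i` in `L_{i+1}` (same scale as `L_i`, same parent, different position); pairwise
distinct `I_1, …, I_{d-1} ∈ D_j` with `I_i ⊆ L_1` (i.e. `I i / 2 ^ a = L 1`), and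
`J_1, …, J_{n+1} ∈ D_j` with `J_i ⊆ P_i` (i.e. `J i / 2 ^ (a + i - 1) = P i`).
For `0 ≤ k ≤ n`, `C(k) = {I_1, …, I_{d-1}} ∪ {J_{n-k+1}, …, J_{n+1}}` is encoded as
`(Finset.Icc 1 (2 ^ a - 1)).image I ∪ (Finset.Icc (n + 1 - k) (n + 1)).image J`.
Colour classes are indexed by `i : Fin (2 ^ a)`, index `i` corresponding to colour
`i.val + 1 ∈ {1, …, d}`. -/

theorem div_two_pow_eq_of_chain {a N s t x : ℕ} {L : ℕ → ℕ}
    (hchain : ∀ i, 1 ≤ i → i ≤ N → L (i + 1) = L i / 2) (hs : 1 ≤ s) (hst : s ≤ t)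
    (ht : t ≤ N + 1) (hx : x / 2 ^ (a + s - 1) = L s) : x / 2 ^ (a + t - 1) = L t := by
  induction t, hst using Nat.le_induction with
  | base => exact hx
  | succ t hst ih =>
    rw [show a + (t + 1) - 1 = (a + t - 1) + 1 by omega, pow_succ, ← Nat.div_div_eq_div_mul,
      ih (by omega), hchain t (by omega) (by omega)]

/-- **The pairs `(C(k), U(k))` are not previsible.**
For every `0 ≤ k ≤ n - 1`, the pair of collections `(C(k), U(k))`, where
`U(k) = C(k+1) \ C(k) = {J_{n-k}}`, is not `d`-previsible. -/
theorem pairs_not_previsible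
    (a n j : ℕ) (hn : 1 ≤ n) (hj : n + a + 1 ≤ j)
    (L P I J : ℕ → ℕ)
    (hL : ∀ i, 1 ≤ i → i ≤ n + 2 → L i < 2 ^ (j + 1 - (a + i)))
    (hchain : ∀ i, 1 ≤ i → i ≤ n + 1 → L (i + 1) = L i / 2)
    (hP : ∀ i, 1 ≤ i → i ≤ n + 1 → P i / 2 = L i / 2 ∧ P i ≠ L i)
    (hI : ∀ i, 1 ≤ i → i ≤ 2 ^ a - 1 → I i < 2 ^ j ∧ I i / 2 ^ a = L 1)
    (hInj : ∀ i₁ i₂, 1 ≤ i₁ → i₁ ≤ 2 ^ a - 1 → 1 ≤ i₂ → i₂ ≤ 2 ^ a - 1 →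
      I i₁ = I i₂ → i₁ = i₂)
    (hJ : ∀ i, 1 ≤ i → i ≤ n + 1 → J i < 2 ^ j ∧ J i / 2 ^ (a + i - 1) = P i)
    (ha : 1 ≤ a) (k : ℕ) (hk : k ≤ n - 1) :
    (((Finset.Icc 1 (2 ^ a - 1)).image I ∪ (Finset.Icc (n - k) (n + 1)).image J) \
        ((Finset.Icc 1 (2 ^ a - 1)).image I ∪ (Finset.Icc (n + 1 - k) (n + 1)).image J)
      = {J (n - k)}) ∧
    ¬ Previsible j (2 ^ a)
      ((Finset.Icc 1 (2 ^ a - 1)).image I ∪ (Finset.Icc (n + 1 - k) (n + 1)).image J)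
      (((Finset.Icc 1 (2 ^ a - 1)).image I ∪ (Finset.Icc (n - k) (n + 1)).image J) \
        ((Finset.Icc 1 (2 ^ a - 1)).image I ∪
          (Finset.Icc (n + 1 - k) (n + 1)).image J)) := by
  obtain ⟨r, rfl⟩ : ∃ r, n = r + k := ⟨n - k, by omega⟩
  have hr : 1 ≤ r := by omega
  rw [show r + k - k = r by omega, show r + k + 1 - k = r + 1 by omega]
  have hIL : ∀ i ∈ Finset.Icc 1 (2 ^ a - 1), ∀ t, 1 ≤ t → t ≤ r + k + 2 →
      I i / 2 ^ (a + t - 1) = L t := fun i hi t ht ht' => by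
    rw [Finset.mem_Icc] at hi
    exact div_two_pow_eq_of_chain hchain le_rfl ht ht' (by simpa using (hI i hi.1 hi.2).2)
  have hParent : ∀ {x} t, 1 ≤ t → t ≤ r + k + 1 → x / 2 ^ (a + t - 1) = P t →
      x / 2 ^ (a + (t + 1) - 1) = L (t + 1) := fun {x} t ht ht' hx => by
    rw [show a + (t + 1) - 1 = (a + t - 1) + 1 by omega, pow_succ, ← Nat.div_div_eq_div_mul,
      hx, hchain t ht ht', (hP t ht ht').1]
  have hPL : ∀ {x} s t, 1 ≤ s → s < t → t ≤ r + k + 1 → x / 2 ^ (a + s - 1) = P s →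
      x / 2 ^ (a + t - 1) ≠ P t := fun {x} s t hs hst ht hx h =>
    (hP t (by omega) ht).2 <| h.symm.trans <| div_two_pow_eq_of_chain hchain (by omega) hst
      (by omega) (hParent s hs (by omega) hx)
  have hIJ : ∀ i ∈ Finset.Icc 1 (2 ^ a - 1), I i ≠ J r := fun i hi h =>
    (hP r hr (by omega)).2 <| by
      rw [← (hJ r hr (by omega)).2, ← h, hIL i hi r hr (by omega)]
  have hU : (((Finset.Icc 1 (2 ^ a - 1)).image I ∪ (Finset.Icc r (r + k + 1)).image J) \
      ((Finset.Icc 1 (2 ^ a - 1)).image I ∪ (Finset.Icc (r + 1) (r + k + 1)).image J))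
      = {J r} := by
    rw [← Finset.insert_Icc_add_one_left_eq_Icc (show r ≤ r + k + 1 by omega),
      Finset.image_insert, Finset.union_insert, Finset.insert_sdiff_of_notMem,
      Finset.sdiff_self, insert_empty_eq]
    rw [Finset.mem_union, Finset.mem_image, Finset.mem_image]
    rintro (⟨i, hi, h⟩ | ⟨i, hi, h⟩)
    · exact hIJ i hi h
    · rw [Finset.mem_Icc] at hi
      exact hPL r i hr (by omega) hi.2 (hJ r hr (by omega)).2
        (h ▸ (hJ i (by omega) hi.2).2)
  refine ⟨hU, fun hprev => ?_⟩
  rw [hU] at hprev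
  have hPr := hP (r + 1) (by omega) (by omega)
  have hcr : L (r + 2) = L (r + 1) / 2 := hchain (r + 1) (by omega) (by omega)
  have hscale : j - (j + 1 - (a + (r + 2)) + 1) = a + (r + 1) - 1 := by omega
  have hd : 2 ≤ 2 ^ a := Nat.le_self_pow (by omega) 2
  have hJL : J r / 2 ^ (a + (r + 1) - 1) = L (r + 1) :=
    hParent r hr (by omega) (hJ r hr (by omega)).2
  have hsmall := hprev (j + 1 - (a + (r + 2))) (by omega) (L (r + 2))
    (hL _ (by omega) (by omega)) (P (r + 1)) (L (r + 1)) (by omega)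
  simp only [restrict, hscale] at hsmall
  refine absurd (hsmall ?_ ?_) (not_or.2 ⟨fun h => ?_, fun h => ?_⟩)
  · refine (Finset.card_le_card (t := {J (r + 1)}) fun x hx => ?_).trans_lt
      (by rw [Finset.card_singleton]; omega)
    simp only [Finset.mem_filter, Finset.mem_union, Finset.mem_image,
      Finset.mem_singleton] at hx ⊢
    obtain ⟨(⟨i, hi, rfl⟩ | ⟨i, hi, rfl⟩) | rfl, hx⟩ := hx
    · exact absurd (hx.symm.trans (hIL i hi _ (by omega) (by omega))) hPr.2
    · rw [Finset.mem_Icc] at hi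
      obtain rfl | hlt := hi.1.eq_or_lt
      · rfl
      · exact absurd (hJ i (by omega) hi.2).2 (hPL (r + 1) i (by omega) hlt hi.2 hx)
    · exact absurd (hx.symm.trans hJL) hPr.2
  · have hcard : (insert (J r) ((Finset.Icc 1 (2 ^ a - 1)).image I)).card = 2 ^ a := by
      rw [Finset.card_insert_of_notMem, Finset.card_image_of_injOn, Nat.card_Icc]
      · omega
      · intro x hx y hy hxy
        simp only [Finset.coe_Icc, Set.mem_Icc] at hx hy
        exact hInj x y hx.1 hx.2 hy.1 hy.2 hxy
      · rw [Finset.mem_image]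
        rintro ⟨i, hi, h⟩
        exact hIJ i hi h
    refine hcard.ge.trans (Finset.card_le_card fun x hx => ?_)
    rw [Finset.mem_insert, Finset.mem_image] at hx
    obtain rfl | ⟨i, hi, rfl⟩ := hx
    · exact Finset.mem_filter.2 ⟨Finset.mem_union_right _ (Finset.mem_singleton_self _), hJL⟩
    · refine Finset.mem_filter.2 ⟨?_, hIL i hi _ (by omega) (by omega)⟩
      exact Finset.mem_union_left _ (Finset.mem_union_left _ (Finset.mem_image_of_mem I hi))
  · exact Finset.notMem_empty (J r) (h ▸ Finset.mem_filter.2 ⟨Finset.mem_singleton_self _, hJL⟩)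
  · have h1 : 1 ∈ Finset.Icc 1 (2 ^ a - 1) := Finset.mem_Icc.2 (by omega)
    refine Finset.notMem_empty (I 1) (h ▸ Finset.mem_filter.2 ⟨?_, ?_⟩)
    · exact Finset.mem_union_left _ (Finset.mem_image_of_mem I h1)
    · exact hIL 1 h1 _ (by omega) (by omega)
end
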